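/- arXiv:2107.08153 — 2 statements merged into one kernel-verified Lean document; each statement's English description precedes it below -/
import Mathlib

section
/- Let (u, b) be a Fisher market with n buyers and m goods of unit supply, where each u_i : ℝ^m → ℝ is continuous, concave on the nonnegative orthant, positively homogeneous of degree 1 there, nonnegative on the nonnegative orthant, represents locally non-satiated preferences, has { x ≥ 0 : u_i(x) ≥ 1 } nonempty, has e_i(q, 1) finite and strictly positive for every q with strictly positive entries, and each b_i > 0. Define φ(p) = Σ_{j=1}^m p_j − Σ_{i=1}^n b_i·log(e_i(p, 1)) on the set of price vectors with strictly positive entries. Then for every p with strictly positive entries, the subdifferential of the convex function φ at p, namely { g ∈ ℝ^m : φ(q) ≥ φ(p) + g·(q − p) for all q with strictly positive entries }, is equal to the negative excess demand set { 1_m − Σ_{i=1}^n x_i : x_i ∈ M_i(p, b_i) for each i }, where 1_m is the all-ones vector. -/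
/-- The expenditure function `e(p, ū) = inf { p·x : x ≥ 0, u(x) ≥ ū }`. -/
noncomputable def expend {m : ℕ} (u : (Fin m → ℝ) → ℝ) (p : Fin m → ℝ) (ubar : ℝ) : ℝ :=
  sInf {c : ℝ | ∃ x : Fin m → ℝ, (∀ j, 0 ≤ x j) ∧ ubar ≤ u x ∧ c = ∑ j, p j * x j}

/-- The indirect utility function `v(p, b) = sup { u(x) : x ≥ 0, p·x ≤ b }`. -/
noncomputable def indirectUtil {m : ℕ} (u : (Fin m → ℝ) → ℝ) (p : Fin m → ℝ) (b : ℝ) : ℝ :=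
  sSup {c : ℝ | ∃ x : Fin m → ℝ, (∀ j, 0 ≤ x j) ∧ (∑ j, p j * x j) ≤ b ∧ c = u x}

/-- The Marshallian demand `M(p, b) = { x ≥ 0 : p·x ≤ b, u(x) = v(p, b) }`. -/
noncomputable def marshallian {m : ℕ} (u : (Fin m → ℝ) → ℝ) (p : Fin m → ℝ) (b : ℝ) :
    Set (Fin m → ℝ) :=
  {x | (∀ j, 0 ≤ x j) ∧ (∑ j, p j * x j) ≤ b ∧ u x = indirectUtil u p b}

open Filter Topology

/-- The bundles affordable at prices `p` with budget `b` that satisfy the optimality condition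
`b * u z ≤ u x * (p ⬝ᵥ z)` for every bundle `z`. For homogeneous utilities this is the
Marshallian demand, in a form that is visibly closed in `(p, x)`. -/
def homogeneousDemand {m : ℕ} (u : (Fin m → ℝ) → ℝ) (p : Fin m → ℝ) (b : ℝ) :
    Set (Fin m → ℝ) :=
  {x | 0 ≤ x ∧ p ⬝ᵥ x ≤ b ∧ ∀ z, 0 ≤ z → b * u z ≤ u x * (p ⬝ᵥ z)}

section SingleBuyer

variable {m : ℕ} {u : (Fin m → ℝ) → ℝ} {p q x : Fin m → ℝ} {b : ℝ}

theorem mem_Icc_of_dotProduct_le {r : Fin m → ℝ} (hr : ∀ j, 0 < r j) (hrq : r ≤ q) (hx : 0 ≤ x)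
    (h : q ⬝ᵥ x ≤ b) : x ∈ Set.Icc 0 (fun j => b / r j) := by
  refine ⟨hx, fun j => ?_⟩
  rw [le_div_iff₀ (hr j)]
  have h1 : q j * x j ≤ q ⬝ᵥ x :=
    Finset.single_le_sum (f := fun j => q j * x j)
      (fun k _ => mul_nonneg ((hr k).le.trans (hrq k)) (hx k)) (Finset.mem_univ j)
  nlinarith [mul_le_mul_of_nonneg_right (hrq j) (hx j)]

theorem isCompact_budgetSet (hp : ∀ j, 0 < p j) (b : ℝ) :
    IsCompact {x : Fin m → ℝ | 0 ≤ x ∧ p ⬝ᵥ x ≤ b} := by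
  refine isCompact_Icc.of_isClosed_subset ?_
    fun x hx => mem_Icc_of_dotProduct_le hp le_rfl hx.1 hx.2
  have h1 : IsClosed {x : Fin m → ℝ | 0 ≤ x} := isClosed_le continuous_const continuous_id
  have h2 : IsClosed {x : Fin m → ℝ | p ⬝ᵥ x ≤ b} :=
    isClosed_le (continuous_const.dotProduct continuous_id) continuous_const
  exact h1.inter h2

theorem isClosed_homogeneousDemand (hu : Continuous u) (b : ℝ) :
    IsClosed {w : (Fin m → ℝ) × (Fin m → ℝ) | w.2 ∈ homogeneousDemand u w.1 b} := by
  have h1 : IsClosed {w : (Fin m → ℝ) × (Fin m → ℝ) | 0 ≤ w.2} :=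
    isClosed_le continuous_const continuous_snd
  have h2 : IsClosed {w : (Fin m → ℝ) × (Fin m → ℝ) | w.1 ⬝ᵥ w.2 ≤ b} :=
    isClosed_le (continuous_fst.dotProduct continuous_snd) continuous_const
  have h3 : IsClosed {w : (Fin m → ℝ) × (Fin m → ℝ) |
      ∀ z, 0 ≤ z → b * u z ≤ u w.2 * (w.1 ⬝ᵥ z)} := by
    simp only [Set.ofPred_forall]
    refine isClosed_iInter fun z => isClosed_iInter fun _ => ?_
    exact isClosed_le continuous_const
      ((hu.comp continuous_snd).mul (continuous_fst.dotProduct continuous_const))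
  exact h1.inter (h2.inter h3)

theorem isMaxOn_budgetSet_of_mem_homogeneousDemand (hb : 0 < b)
    (hnn : ∀ x, 0 ≤ x → 0 ≤ u x) (hx : x ∈ homogeneousDemand u p b) :
    IsMaxOn u {x | 0 ≤ x ∧ p ⬝ᵥ x ≤ b} x := by
  rintro z ⟨hz, hzb⟩
  have h := hx.2.2 z hz
  have := mul_le_mul_of_nonneg_left hzb (hnn x hx.1)
  exact le_of_mul_le_mul_left (by linarith) hb

theorem mem_homogeneousDemand_of_isMaxOn
    (hom : ∀ c : ℝ, 0 < c → ∀ x, 0 ≤ x → u (c • x) = c * u x)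
    (hp : ∀ j, 0 < p j) (hb : 0 < b) (hx : 0 ≤ x) (hxb : p ⬝ᵥ x ≤ b)
    (hmax : IsMaxOn u {x | 0 ≤ x ∧ p ⬝ᵥ x ≤ b} x) : x ∈ homogeneousDemand u p b := by
  refine ⟨hx, hxb, fun z hz => ?_⟩
  have hterm : ∀ j ∈ Finset.univ, 0 ≤ p j * z j := fun j _ => mul_nonneg (hp j).le (hz j)
  have hpz : 0 ≤ p ⬝ᵥ z := Finset.sum_nonneg hterm
  rcases hpz.eq_or_lt with h0 | hpos
  · have hz0 : z = 0 := by
      funext j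
      have := (Finset.sum_eq_zero_iff_of_nonneg hterm).1 h0.symm j (Finset.mem_univ j)
      exact (mul_eq_zero.1 this).resolve_left (hp j).ne'
    have hu0 : u 0 = 0 := by
      have := hom 2 two_pos 0 le_rfl
      rw [smul_zero] at this
      linarith
    simp [hz0, hu0]
  · have hc : 0 < b / (p ⬝ᵥ z) := div_pos hb hpos
    have hmem : (b / (p ⬝ᵥ z)) • z ∈ {x | 0 ≤ x ∧ p ⬝ᵥ x ≤ b} := by
      refine ⟨smul_nonneg hc.le hz, ?_⟩
      rw [dotProduct_smul, smul_eq_mul, div_mul_cancel₀ _ hpos.ne']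
    have h : u ((b / (p ⬝ᵥ z)) • z) ≤ u x := hmax hmem
    rwa [hom _ hc z hz, div_mul_eq_mul_div, div_le_iff₀ hpos] at h

theorem marshallian_eq_homogeneousDemand (hu : Continuous u)
    (hom : ∀ c : ℝ, 0 < c → ∀ x, 0 ≤ x → u (c • x) = c * u x)
    (hnn : ∀ x, 0 ≤ x → 0 ≤ u x) (hp : ∀ j, 0 < p j) (hb : 0 < b) :
    marshallian u p b = homogeneousDemand u p b := by
  have hset : {c : ℝ | ∃ x : Fin m → ℝ, (∀ j, 0 ≤ x j) ∧ (∑ j, p j * x j) ≤ b ∧ c = u x} =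
      u '' {x | 0 ≤ x ∧ p ⬝ᵥ x ≤ b} := by
    ext c
    constructor
    · rintro ⟨x, h1, h2, rfl⟩
      exact ⟨x, ⟨h1, h2⟩, rfl⟩
    · rintro ⟨x, ⟨h1, h2⟩, rfl⟩
      exact ⟨x, h1, h2, rfl⟩
  ext x
  simp only [marshallian, indirectUtil, hset, Set.mem_ofPred_eq]
  constructor
  · rintro ⟨hx, hxb, hux⟩
    refine mem_homogeneousDemand_of_isMaxOn hom hp hb hx hxb fun z hz => ?_
    rw [Set.mem_ofPred_eq, hux]
    exact le_csSup ((isCompact_budgetSet hp b).image hu).bddAbove (Set.mem_image_of_mem u hz)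
  · intro hx
    have hmax := isMaxOn_budgetSet_of_mem_homogeneousDemand hb hnn hx
    refine ⟨hx.1, hx.2.1, (IsGreatest.csSup_eq ⟨?_, ?_⟩).symm⟩
    · exact Set.mem_image_of_mem u ⟨hx.1, hx.2.1⟩
    · rintro _ ⟨z, hz, rfl⟩
      exact hmax hz

theorem homogeneousDemand_nonempty (hu : Continuous u)
    (hom : ∀ c : ℝ, 0 < c → ∀ x, 0 ≤ x → u (c • x) = c * u x)
    (hp : ∀ j, 0 < p j) (hb : 0 < b) : (homogeneousDemand u p b).Nonempty := by
  obtain ⟨x, ⟨hx, hxb⟩, hmax⟩ := (isCompact_budgetSet hp b).exists_isMaxOn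
    ⟨0, le_rfl, by simpa using hb.le⟩ hu.continuousOn
  exact ⟨x, mem_homogeneousDemand_of_isMaxOn hom hp hb hx hxb hmax⟩

theorem convex_homogeneousDemand (hconc : ConcaveOn ℝ {x : Fin m → ℝ | ∀ j, 0 ≤ x j} u)
    (hp : ∀ j, 0 < p j) (b : ℝ) : Convex ℝ (homogeneousDemand u p b) := by
  rintro x ⟨hx, hxb, hxo⟩ y ⟨hy, hyb, hyo⟩ s t hs ht hst
  refine ⟨add_nonneg (smul_nonneg hs hx) (smul_nonneg ht hy), ?_, fun z hz => ?_⟩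
  · rw [dotProduct_add, dotProduct_smul, dotProduct_smul, smul_eq_mul, smul_eq_mul]
    calc s * (p ⬝ᵥ x) + t * (p ⬝ᵥ y) ≤ s * b + t * b := by gcongr
      _ = b := by rw [← add_mul, hst, one_mul]
  · have hpz : 0 ≤ p ⬝ᵥ z := Finset.sum_nonneg fun j _ => mul_nonneg (hp j).le (hz j)
    have hcc : s * u x + t * u y ≤ u (s • x + t • y) := hconc.2 hx hy hs ht hst
    calc b * u z = s * (b * u z) + t * (b * u z) := by rw [← add_mul, hst, one_mul]
      _ ≤ s * (u x * (p ⬝ᵥ z)) + t * (u y * (p ⬝ᵥ z)) :=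
        add_le_add (mul_le_mul_of_nonneg_left (hxo z hz) hs)
          (mul_le_mul_of_nonneg_left (hyo z hz) ht)
      _ = (s * u x + t * u y) * (p ⬝ᵥ z) := by ring
      _ ≤ u (s • x + t • y) * (p ⬝ᵥ z) := by gcongr

theorem expend_one_le (hom : ∀ c : ℝ, 0 < c → ∀ x, 0 ≤ x → u (c • x) = c * u x)
    (hq : ∀ j, 0 < q j) (hx : 0 ≤ x) (hux : 0 < u x) : expend u q 1 ≤ (q ⬝ᵥ x) / u x := by
  refine csInf_le ⟨0, ?_⟩ ⟨(u x)⁻¹ • x, smul_nonneg (inv_nonneg.2 hux.le) hx, ?_, ?_⟩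
  · rintro c ⟨z, hz, -, rfl⟩
    exact Finset.sum_nonneg fun j _ => mul_nonneg (hq j).le (hz j)
  · rw [hom _ (inv_pos.2 hux) x hx, inv_mul_cancel₀ hux.ne']
  · change _ = q ⬝ᵥ ((u x)⁻¹ • x)
    rw [dotProduct_smul, smul_eq_mul, div_eq_inv_mul]

theorem log_expend_sub_log_expend_le
    (hom : ∀ c : ℝ, 0 < c → ∀ x, 0 ≤ x → u (c • x) = c * u x)
    (hne : ∃ x : Fin m → ℝ, (∀ j, 0 ≤ x j) ∧ 1 ≤ u x)
    (hp : ∀ j, 0 < p j) (hq : ∀ j, 0 < q j) (heq : 0 < expend u q 1) (hb : 0 < b)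
    (hx : x ∈ homogeneousDemand u p b) :
    b * Real.log (expend u q 1) - b * Real.log (expend u p 1) ≤ (q - p) ⬝ᵥ x := by
  obtain ⟨hx0, hxb, hxo⟩ := hx
  obtain ⟨z, hz, huz⟩ := hne
  have hpz : 0 ≤ p ⬝ᵥ z := Finset.sum_nonneg fun j _ => mul_nonneg (hp j).le (hz j)
  have hux : 0 < u x := by
    have h : 0 < u x * (p ⬝ᵥ z) :=
      lt_of_lt_of_le (mul_pos hb (one_pos.trans_le huz)) (hxo z hz)
    exact pos_of_mul_pos_left h hpz
  have hge : b / u x ≤ expend u p 1 := by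
    refine le_csInf ⟨_, z, hz, huz, rfl⟩ ?_
    rintro c ⟨w, hw, huw, rfl⟩
    rw [div_le_iff₀' hux]
    exact le_trans (by nlinarith) (hxo w hw)
  have hle := expend_one_le hom hp hx0 hux
  have hpx : b ≤ p ⬝ᵥ x := (div_le_div_iff_of_pos_right hux).1 (hge.trans hle)
  have hqx := expend_one_le hom hq hx0 hux
  have hlog : Real.log (expend u q 1) - Real.log (expend u p 1) ≤ (q ⬝ᵥ x) / b - 1 := by
    have hep : 0 < expend u p 1 := (div_pos hb hux).trans_le hge
    rw [← Real.log_div heq.ne' hep.ne']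
    refine (Real.log_le_sub_one_of_pos (div_pos heq hep)).trans (sub_le_sub_right ?_ 1)
    calc expend u q 1 / expend u p 1 ≤ ((q ⬝ᵥ x) / u x) / (b / u x) :=
          div_le_div₀ (heq.le.trans hqx) hqx (div_pos hb hux) hge
      _ = (q ⬝ᵥ x) / b := div_div_div_cancel_right₀ hux.ne' _ _
  calc b * Real.log (expend u q 1) - b * Real.log (expend u p 1)
      = b * (Real.log (expend u q 1) - Real.log (expend u p 1)) := by ring
    _ ≤ b * ((q ⬝ᵥ x) / b - 1) := by gcongr
    _ = q ⬝ᵥ x - b := by field_simp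
    _ ≤ (q - p) ⬝ᵥ x := by rw [sub_dotProduct]; linarith

end SingleBuyer

/-- If `-∑ i, b i * log (e i q)` has a subgradient `-y` at `p`, then in every direction `d` some
aggregate demand at `p` has inner product with `d` at most that of `y`. -/
theorem exists_demand_dotProduct_le {n m : ℕ} {u : Fin n → (Fin m → ℝ) → ℝ} {b : Fin n → ℝ}
    {p : Fin m → ℝ} (hu_cont : ∀ i, Continuous (u i))
    (hu_hom : ∀ i, ∀ c : ℝ, 0 < c → ∀ x, 0 ≤ x → u i (c • x) = c * u i x)
    (hu_ne : ∀ i, ∃ x : Fin m → ℝ, (∀ j, 0 ≤ x j) ∧ 1 ≤ u i x)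
    (he_pos : ∀ i, ∀ q : Fin m → ℝ, (∀ j, 0 < q j) → 0 < expend (u i) q 1)
    (hb : ∀ i, 0 < b i) (hp : ∀ j, 0 < p j) {y : Fin m → ℝ}
    (hy : ∀ q : Fin m → ℝ, (∀ j, 0 < q j) →
      ∑ i, (b i * Real.log (expend (u i) q 1) - b i * Real.log (expend (u i) p 1)) ≤
        (q - p) ⬝ᵥ y) (d : Fin m → ℝ) :
    ∃ x : Fin n → Fin m → ℝ, (∀ i, x i ∈ homogeneousDemand (u i) p (b i)) ∧
      d ⬝ᵥ ∑ i, x i ≤ d ⬝ᵥ y := by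
  have hcont : Continuous fun t : ℝ => p + t • d := by fun_prop
  have hev : ∀ᶠ t : ℝ in 𝓝[>] 0, 0 < t ∧ ∀ j, p j / 2 < (p + t • d) j := by
    refine eventually_mem_nhdsWithin.and (eventually_nhdsWithin_of_eventually_nhds ?_)
    refine eventually_all.2 fun j => ?_
    refine ((continuous_apply j).comp hcont).continuousAt.eventually (lt_mem_nhds ?_)
    simpa using half_lt_self (hp j)
  obtain ⟨t, ht, htp⟩ := exists_seq_forall_of_frequently hev.frequently
  have hr : ∀ j, 0 < p j / 2 := fun j => half_pos (hp j)
  have hqpos : ∀ k j, 0 < (p + t k • d) j := fun k j => (hr j).trans ((htp k).2 j)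
  choose X hX using fun k i => homogeneousDemand_nonempty (hu_cont i) (hu_hom i) (hqpos k) (hb i)
  have hXd : ∀ k, d ⬝ᵥ ∑ i, X k i ≤ d ⬝ᵥ y := by
    intro k
    have h1 : ∀ i, t k * (d ⬝ᵥ X k i) ≤
        b i * Real.log (expend (u i) (p + t k • d) 1) - b i * Real.log (expend (u i) p 1) := by
      intro i
      have := log_expend_sub_log_expend_le (hu_hom i) (hu_ne i) (hqpos k) hp (he_pos i p hp)
        (hb i) (hX k i)
      rw [sub_add_cancel_left, neg_dotProduct, smul_dotProduct, smul_eq_mul] at this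
      linarith
    have h2 := (Finset.sum_le_sum fun i _ => h1 i).trans (hy _ (hqpos k))
    rw [add_sub_cancel_left, smul_dotProduct, smul_eq_mul, ← Finset.mul_sum,
      ← dotProduct_sum] at h2
    exact le_of_mul_le_mul_left h2 (htp k).1
  have hK : IsCompact (Set.univ.pi fun i : Fin n =>
      Set.Icc (0 : Fin m → ℝ) (fun j => b i / (p j / 2))) :=
    isCompact_univ_pi fun _ => isCompact_Icc
  obtain ⟨x, -, f, hf, hlim⟩ := hK.tendsto_subseq (x := X) fun k i _ =>
    mem_Icc_of_dotProduct_le hr (fun j => ((htp k).2 j).le) (hX k i).1 (hX k i).2.1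
  have hq : Tendsto (fun k => p + t (f k) • d) atTop (𝓝 p) := by
    have := (hcont.tendsto 0).comp
      ((tendsto_nhds_of_tendsto_nhdsWithin ht).comp hf.tendsto_atTop)
    simpa [Function.comp_def] using this
  have hxi : ∀ i, Tendsto (fun k => X (f k) i) atTop (𝓝 (x i)) := fun i =>
    ((continuous_apply i).tendsto x).comp hlim
  refine ⟨x, fun i => ?_, ?_⟩
  · exact (isClosed_homogeneousDemand (hu_cont i) (b i)).mem_of_tendsto (hq.prodMk_nhds (hxi i))
      (Eventually.of_forall fun k => hX (f k) i)
  · have hsum : Continuous fun w : Fin n → Fin m → ℝ => d ⬝ᵥ ∑ i, w i :=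
      continuous_const.dotProduct (continuous_finsetSum _ fun i _ => continuous_apply i)
    exact le_of_tendsto ((hsum.tendsto x).comp hlim) (Eventually.of_forall fun k => hXd (f k))

/-- The subdifferential at any strictly positive price vector `p` of the
convex potential `φ(q) = Σ_j q_j − Σ_i b_i log(e_i(q, 1))` equals the negative excess
demand set `{ 1_m − Σ_i x_i : x_i ∈ M_i(p, b_i) }`. -/
theorem subdifferential_potential_eq_neg_excess_demand (n m : ℕ)
    (u : Fin n → (Fin m → ℝ) → ℝ) (b : Fin n → ℝ) (p : Fin m → ℝ)
    (hu_cont : ∀ i, Continuous (u i))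
    (hu_conc : ∀ i, ConcaveOn ℝ {x : Fin m → ℝ | ∀ j, 0 ≤ x j} (u i))
    (hu_hom : ∀ i, ∀ c : ℝ, 0 < c → ∀ x : Fin m → ℝ, (∀ j, 0 ≤ x j) →
        u i (c • x) = c * u i x)
    (hu_nonneg : ∀ i, ∀ x : Fin m → ℝ, (∀ j, 0 ≤ x j) → 0 ≤ u i x)
    (hu_lns : ∀ i, ∀ x : Fin m → ℝ, (∀ j, 0 ≤ x j) → ∀ ε : ℝ, 0 < ε →
        ∃ y : Fin m → ℝ, (∀ j, 0 ≤ y j) ∧ ‖y - x‖ < ε ∧ u i x < u i y)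
    (hu_ne : ∀ i, ∃ x : Fin m → ℝ, (∀ j, 0 ≤ x j) ∧ 1 ≤ u i x)
    (he_pos : ∀ i, ∀ q : Fin m → ℝ, (∀ j, 0 < q j) → 0 < expend (u i) q 1)
    (hb : ∀ i, 0 < b i) (hp : ∀ j, 0 < p j) :
    {g : Fin m → ℝ | ∀ q : Fin m → ℝ, (∀ j, 0 < q j) →
        ((∑ j, p j) - ∑ i, b i * Real.log (expend (u i) p 1)) +
          (∑ j, g j * (q j - p j)) ≤
        (∑ j, q j) - ∑ i, b i * Real.log (expend (u i) q 1)} =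
    {g : Fin m → ℝ | ∃ x : Fin n → Fin m → ℝ,
        (∀ i, x i ∈ marshallian (u i) p (b i)) ∧ g = fun j => 1 - ∑ i, x i j} := by
  have hM : ∀ i, marshallian (u i) p (b i) = homogeneousDemand (u i) p (b i) := fun i =>
    marshallian_eq_homogeneousDemand (hu_cont i) (hu_hom i) (hu_nonneg i) hp (hb i)
  have hsub : ∀ g : Fin m → ℝ, (∀ q : Fin m → ℝ, (∀ j, 0 < q j) →
        ((∑ j, p j) - ∑ i, b i * Real.log (expend (u i) p 1)) +
          (∑ j, g j * (q j - p j)) ≤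
        (∑ j, q j) - ∑ i, b i * Real.log (expend (u i) q 1)) ↔
      ∀ q : Fin m → ℝ, (∀ j, 0 < q j) →
        ∑ i, (b i * Real.log (expend (u i) q 1) - b i * Real.log (expend (u i) p 1)) ≤
          (q - p) ⬝ᵥ (1 - g) := by
    refine fun g => forall₂_congr fun q _ => ?_
    have h : (q - p) ⬝ᵥ (1 - g) = (∑ j, q j) - (∑ j, p j) - ∑ j, g j * (q j - p j) := by
      simp only [dotProduct, ← Finset.sum_sub_distrib]
      exact Finset.sum_congr rfl fun j _ => by simp; ring
    rw [h, Finset.sum_sub_distrib]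
    constructor <;> intro <;> linarith
  ext g
  rw [Set.mem_ofPred_eq, hsub, Set.mem_ofPred_eq]
  simp only [hM]
  constructor
  · intro hg
    let D : Set (Fin n → Fin m → ℝ) :=
      Set.univ.pi fun i => homogeneousDemand (u i) p (b i)
    let S : (Fin n → Fin m → ℝ) →ₗ[ℝ] Fin m → ℝ := ∑ i, LinearMap.proj i
    have hS : ∀ x, S x = ∑ i, x i := fun x => by simp [S]
    have hDcompact : IsCompact D := isCompact_univ_pi fun i =>
      (isCompact_budgetSet hp (b i)).of_isClosed_subset
        ((isClosed_homogeneousDemand (hu_cont i) (b i)).preimage (Continuous.prodMk_right p))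
        fun x hx => ⟨hx.1, hx.2.1⟩
    have hDconvex : Convex ℝ D :=
      convex_pi fun i _ => convex_homogeneousDemand (hu_conc i) hp (b i)
    have hmem : 1 - g ∈ S '' D := by
      by_contra hnot
      obtain ⟨f, c, hfc, hcf⟩ := geometric_hahn_banach_point_closed (hDconvex.linear_image S)
        (hDcompact.image S.continuous_of_finiteDimensional).isClosed hnot
      have hf : ∀ w, f w = (fun j => f (Pi.single j 1)) ⬝ᵥ w := fun w => by
        conv_lhs => rw [pi_eq_sum_univ' w]
        simp [dotProduct, mul_comm]
      obtain ⟨x, hx, hle⟩ := exists_demand_dotProduct_le hu_cont hu_hom hu_ne he_pos hb hp hg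
        (fun j => f (Pi.single j 1))
      rw [← hf, ← hf, ← hS] at hle
      exact lt_irrefl _ ((hfc.trans (hcf _ ⟨x, fun i _ => hx i, rfl⟩)).trans_le hle)
    obtain ⟨x, hx, hxg⟩ := hmem
    refine ⟨x, fun i => hx i (Set.mem_univ i), funext fun j => ?_⟩
    have := congrFun hxg j
    simp only [hS, Finset.sum_apply, Pi.sub_apply, Pi.one_apply] at this
    linarith
  · rintro ⟨x, hx, rfl⟩ q hq
    have h : (1 - fun j => 1 - ∑ i, x i j : Fin m → ℝ) = ∑ i, x i := by
      funext j
      simp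
    rw [h, dotProduct_sum]
    exact Finset.sum_le_sum fun i _ => log_expend_sub_log_expend_le (hu_hom i) (hu_ne i) hp hq
      (he_pos i q hq) (hb i) (hx i)
end

section
/- Let u : ℝ^m → ℝ be continuous, concave on the nonnegative orthant, positively homogeneous of degree 1 there, and representing locally non-satiated preferences. Let p ∈ ℝ^m have strictly positive entries and let b > 0. Suppose the Marshallian demand M(p, b) is the singleton {x*} and the Hicksian demand H(p, 1) is the singleton {h*}, and suppose p·h* > 0. Then for every coordinate j, x*_j = b·h*_j / (Σ_{k=1}^m h*_k·p_k); that is, x* = (b / (p·h*))·h*. -/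
/-- The Hicksian demand `H(p, ū) = { x ≥ 0 : u(x) ≥ ū, p·x = e(p, ū) }`. -/
noncomputable def hicksian {m : ℕ} (u : (Fin m → ℝ) → ℝ) (p : Fin m → ℝ) (ubar : ℝ) :
    Set (Fin m → ℝ) :=
  {x | (∀ j, 0 ≤ x j) ∧ ubar ≤ u x ∧ (∑ j, p j * x j) = expend u p ubar}

/-- The expenditure function bounds the cost of every bundle reaching the utility level. -/
lemma expend_le_cost {m : ℕ} {u : (Fin m → ℝ) → ℝ} {p x : Fin m → ℝ} {ubar : ℝ}
    (hp : ∀ j, 0 ≤ p j) (hx : ∀ j, 0 ≤ x j) (hux : ubar ≤ u x) :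
    expend u p ubar ≤ ∑ j, p j * x j := by
  refine csInf_le ⟨0, ?_⟩ ⟨x, hx, hux, rfl⟩
  rintro c ⟨y, hy, -, rfl⟩
  exact Finset.sum_nonneg fun j _ => mul_nonneg (hp j) (hy j)

lemma cost_smul {m : ℕ} (p x : Fin m → ℝ) (c : ℝ) :
    ∑ j, p j * (c • x) j = c * ∑ j, p j * x j := by
  rw [Finset.mul_sum]
  exact Finset.sum_congr rfl fun j _ => by simp only [Pi.smul_apply, smul_eq_mul]; ring

/-- Rescaling a Hicksian bundle at utility level 1 to exhaust the budget gives a Marshallian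
bundle. -/
lemma smul_mem_marshallian {m : ℕ} {u : (Fin m → ℝ) → ℝ} {p h : Fin m → ℝ} {b : ℝ}
    (hu_hom : ∀ c : ℝ, 0 < c → ∀ x : Fin m → ℝ, (∀ j, 0 ≤ x j) → u (c • x) = c * u x)
    (hp : ∀ j, 0 ≤ p j) (hb : 0 < b) (hh : h ∈ hicksian u p 1) (hph : 0 < ∑ k, p k * h k) :
    (b / ∑ k, p k * h k) • h ∈ marshallian u p b := by
  obtain ⟨hh0, hu1, hcost⟩ := hh
  have hs : 0 < b / ∑ k, p k * h k := div_pos hb hph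
  have hy0 : ∀ j, 0 ≤ ((b / ∑ k, p k * h k) • h) j := fun j => mul_nonneg hs.le (hh0 j)
  have hyb : ∑ j, p j * ((b / ∑ k, p k * h k) • h) j ≤ b := by
    rw [cost_smul, div_mul_cancel₀ _ hph.ne']
  have hyu : b / ∑ k, p k * h k ≤ u ((b / ∑ k, p k * h k) • h) := by
    rw [hu_hom _ hs h hh0]
    exact le_mul_of_one_le_right hs.le hu1
  refine ⟨hy0, hyb, Eq.symm ?_⟩
  unfold indirectUtil
  refine IsGreatest.csSup_eq ⟨⟨_, hy0, hyb, rfl⟩, ?_⟩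
  rintro c ⟨x, hx, hxb, rfl⟩
  refine le_trans ?_ hyu
  rcases le_or_gt (u x) 0 with hux | hux
  · exact hux.trans hs.le
  · have hinv : 0 < (u x)⁻¹ := inv_pos.mpr hux
    have hle : expend u p 1 ≤ ∑ j, p j * ((u x)⁻¹ • x) j :=
      expend_le_cost hp (fun j => mul_nonneg hinv.le (hx j))
        (by rw [hu_hom _ hinv x hx, inv_mul_cancel₀ hux.ne'])
    rw [← hcost, cost_smul, le_inv_mul_iff₀ hux] at hle
    rw [le_div_iff₀ hph]
    exact hle.trans hxb

/-- If Marshallian demand `M(p, b) = {x*}` and Hicksian demand at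
utility level 1 `H(p, 1) = {h*}` are singletons with `p·h* > 0`, then
`x* = (b / (p·h*))·h*` coordinatewise. -/
theorem marshallian_eq_scaled_hicksian (m : ℕ) (u : (Fin m → ℝ) → ℝ)
    (p : Fin m → ℝ) (b : ℝ)
    (hu_cont : Continuous u)
    (hu_conc : ConcaveOn ℝ {x : Fin m → ℝ | ∀ j, 0 ≤ x j} u)
    (hu_hom : ∀ c : ℝ, 0 < c → ∀ x : Fin m → ℝ, (∀ j, 0 ≤ x j) → u (c • x) = c * u x)
    (hu_lns : ∀ x : Fin m → ℝ, (∀ j, 0 ≤ x j) → ∀ ε : ℝ, 0 < ε →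
        ∃ y : Fin m → ℝ, (∀ j, 0 ≤ y j) ∧ ‖y - x‖ < ε ∧ u x < u y)
    (hp : ∀ j, 0 < p j) (hb : 0 < b)
    (xstar hstar : Fin m → ℝ)
    (hM : marshallian u p b = {xstar})
    (hH : hicksian u p 1 = {hstar})
    (hph : 0 < ∑ k, p k * hstar k) :
    ∀ j, xstar j = b * hstar j / ∑ k, hstar k * p k := by
  intro j
  have hmem := smul_mem_marshallian hu_hom (fun j => (hp j).le) hb
    (hH ▸ Set.mem_singleton hstar) hph
  rw [hM, Set.mem_singleton_iff] at hmem
  rw [← hmem, Pi.smul_apply, smul_eq_mul, div_mul_eq_mul_div]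
  simp only [mul_comm (p _)]
end
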